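/- Let ψ : ℝ² → ℂ be integrable, let c : ℤ² → ℂ satisfy Σ_{k∈ℤ²} |c_k| < ∞, and let f = Σ_{k∈ℤ²} c_k · ψ(· − k), the series converging absolutely in L¹(ℝ²). Let ψ₂(x₁) = ∫_ℝ ψ(x₁, x₂) dx₂ denote the projection of ψ along the x₂-axis. Then the marginal f₂(x₁) = ∫_ℝ f(x₁, x₂) dx₂ satisfies, for almost every x₁, f₂(x₁) = Σ_{k₁∈ℤ} ( Σ_{k₂∈ℤ} c_{(k₁,k₂)} ) · ψ₂(x₁ − k₁), with all series converging absolutely. That is, the wavelet coefficients of the projected signal are obtained by summing the original coefficients over the projection direction (Eq. 14 of the paper). -/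

import Mathlib

open MeasureTheory Real

/-- The point `(x, y)` of the Euclidean plane. -/
noncomputable def v2 (x y : ℝ) : EuclideanSpace ℝ (Fin 2) :=
  (WithLp.equiv 2 (Fin 2 → ℝ)).symm ![x, y]

/-- If `∑ᵢ ∫ ‖F i‖` converges then `∑ᵢ ‖F i x‖` converges for almost every `x`. -/
theorem ae_summable_norm_of_summable_integral_norm {ι α E : Type*} [Countable ι]
    [MeasurableSpace α] [NormedAddCommGroup E] {μ : Measure α} {F : ι → α → E}
    (hF : ∀ i, Integrable (F i) μ) (hsum : Summable fun i => ∫ x, ‖F i x‖ ∂μ) :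
    ∀ᵐ x ∂μ, Summable fun i => ‖F i x‖ := by
  refine summable_norm_of_tsum_eLpNorm_ne_top le_rfl (fun i => (hF i).1) ?_
  simp_rw [eLpNorm_one_eq_lintegral_enorm, ← ofReal_integral_norm_eq_lintegral_enorm (hF _)]
  exact hsum.tsum_ofReal_ne_top

/-- Termwise partial integration of an `L¹`-convergent series on a product space. -/
theorem ae_hasSum_integral_prod_of_summable_integral_norm {ι α β E : Type*} [Countable ι]
    [MeasurableSpace α] [MeasurableSpace β] [NormedAddCommGroup E] [NormedSpace ℝ E]
    {μ : Measure α} {ν : Measure β} [SFinite μ] [SFinite ν] {F : ι → α × β → E}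
    (hF : ∀ i, Integrable (F i) (μ.prod ν))
    (hsum : Summable fun i => ∫ z, ‖F i z‖ ∂(μ.prod ν)) :
    ∀ᵐ x ∂μ, (Summable fun i => ‖∫ y, F i (x, y) ∂ν‖) ∧
      HasSum (fun i => ∫ y, F i (x, y) ∂ν) (∫ y, ∑' i, F i (x, y) ∂ν) := by
  have hmarginal : ∀ᵐ x ∂μ, Summable fun i => ‖∫ y, ‖F i (x, y)‖ ∂ν‖ := by
    refine ae_summable_norm_of_summable_integral_norm
      (fun i => (hF i).integral_norm_prod_left) ?_
    refine hsum.congr fun i => ?_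
    rw [integral_prod _ (hF i).norm]
    exact integral_congr_ae <| .of_forall fun x =>
      (norm_of_nonneg (integral_nonneg fun y => norm_nonneg (F i (x, y)))).symm
  filter_upwards [hmarginal, ae_all_iff.2 fun i => (hF i).prod_right_ae] with x hx hint
  refine ⟨hx.of_nonneg_of_le (fun _ => norm_nonneg _) fun i =>
    (norm_integral_le_integral_norm _).trans (le_abs_self _), ?_⟩
  exact hasSum_integral_of_summable_integral_norm hint
    (hx.congr fun i => norm_of_nonneg (integral_nonneg fun y => norm_nonneg _))

theorem measurePreserving_v2 : MeasurePreserving (fun p : ℝ × ℝ => v2 p.1 p.2) :=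
  (PiLp.volume_preserving_toLp (Fin 2)).comp (volume_preserving_finTwoArrow ℝ).symm

theorem measurableEmbedding_v2 : MeasurableEmbedding (fun p : ℝ × ℝ => v2 p.1 p.2) :=
  (MeasurableEquiv.toLp 2 (Fin 2 → ℝ)).measurableEmbedding.comp
    (MeasurableEquiv.finTwoArrow (α := ℝ)).symm.measurableEmbedding

theorem v2_sub (a b a' b' : ℝ) : v2 a b - v2 a' b' = v2 (a - a') (b - b') := by
  ext i
  fin_cases i <;> simp [v2]

/-- **Projection of a wavelet series (Eq. 14 of the paper).**
Let `ψ : ℝ² → ℂ` be integrable, `c : ℤ² → ℂ` absolutely summable and let `f` be the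
(integrable) superposition `f x = ∑ₖ c k • ψ (x - k)`, converging absolutely a.e.
With `ψ₂ x₁ = ∫ x₂, ψ (x₁, x₂)` the projection of `ψ` along the `x₂`-axis, every inner
series `∑_{k₂} c (k₁, k₂)` converges absolutely, and for a.e. `x₁` the marginal
`f₂ x₁ = ∫ x₂, f (x₁, x₂)` equals `∑_{k₁} (∑_{k₂} c (k₁,k₂)) * ψ₂ (x₁ - k₁)`, the outer
series converging absolutely as well. -/
theorem projection_wavelet_series (ψ : EuclideanSpace ℝ (Fin 2) → ℂ)
    (hψ : Integrable ψ) (c : ℤ × ℤ → ℂ) (hc : Summable fun k : ℤ × ℤ => ‖c k‖)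
    (f : EuclideanSpace ℝ (Fin 2) → ℂ) (hf : Integrable f)
    (hfψ : ∀ᵐ x : EuclideanSpace ℝ (Fin 2),
      f x = ∑' k : ℤ × ℤ, c k * ψ (x - v2 (k.1 : ℝ) (k.2 : ℝ))) :
    (∀ k₁ : ℤ, Summable fun k₂ : ℤ => ‖c (k₁, k₂)‖) ∧
    ∀ᵐ x₁ : ℝ,
      (Summable fun k₁ : ℤ =>
        ‖(∑' k₂ : ℤ, c (k₁, k₂)) * ∫ x₂ : ℝ, ψ (v2 (x₁ - (k₁ : ℝ)) x₂)‖) ∧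
      (∫ x₂ : ℝ, f (v2 x₁ x₂)) =
        ∑' k₁ : ℤ, (∑' k₂ : ℤ, c (k₁, k₂)) * ∫ x₂ : ℝ, ψ (v2 (x₁ - (k₁ : ℝ)) x₂) := by
  have hint : Integrable (fun p : ℝ × ℝ => ψ (v2 p.1 p.2)) (volume.prod volume) :=
    (measurePreserving_v2.integrable_comp_emb measurableEmbedding_v2).2 hψ
  let F : ℤ × ℤ → ℝ × ℝ → ℂ := fun k p => c k * ψ (v2 (p.1 - k.1) (p.2 - k.2))
  have hF : ∀ k, Integrable (F k) (volume.prod volume) := fun k =>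
    (hint.comp_sub_right ((k.1 : ℝ), (k.2 : ℝ))).const_mul (c k)
  have hFsum : Summable fun k => ∫ p, ‖F k p‖ ∂(volume.prod volume) := by
    have hnorm : ∀ k, ∫ p, ‖F k p‖ ∂(volume.prod volume) =
        ‖c k‖ * ∫ p : ℝ × ℝ, ‖ψ (v2 p.1 p.2)‖ ∂(volume.prod volume) := fun k => by
      simp only [F, norm_mul, integral_const_mul]
      congr 1
      exact integral_sub_right_eq_self (fun p : ℝ × ℝ => ‖ψ (v2 p.1 p.2)‖)
        ((k.1 : ℝ), (k.2 : ℝ))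
    simp_rw [hnorm]
    exact hc.mul_right _
  have hmarginal : ∀ (k : ℤ × ℤ) (x : ℝ),
      ∫ y, F k (x, y) = c k * ∫ y, ψ (v2 (x - k.1) y) := fun k x => by
    simp only [F, integral_const_mul]
    rw [integral_sub_right_eq_self (fun y : ℝ => ψ (v2 (x - k.1) y)) (k.2 : ℝ)]
  have hfF : ∀ᵐ p : ℝ × ℝ ∂(volume.prod volume), f (v2 p.1 p.2) = ∑' k, F k p := by
    filter_upwards [measurePreserving_v2.quasiMeasurePreserving.ae hfψ] with p hp
    simpa only [v2_sub] using hp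
  refine ⟨hc.prod_factor, ?_⟩
  filter_upwards [ae_hasSum_integral_prod_of_summable_integral_norm hF hFsum,
    Measure.ae_ae_of_ae_prod hfF] with x ⟨hnorm, hsum⟩ hfx
  simp_rw [hmarginal] at hnorm hsum
  simp_rw [← tsum_mul_right]
  refine ⟨hnorm.prod.of_nonneg_of_le (fun _ => norm_nonneg _) fun k₁ =>
    norm_tsum_le_tsum_norm (hnorm.prod_factor k₁), ?_⟩
  rw [integral_congr_ae hfx, ← hsum.tsum_eq, hsum.summable.tsum_prod]
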